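/- Let (Q,P) be a weakly quasi-lattice ordered group and let Λ be a P-graph. For each composable pair (λ,λ') in Λ, the left-shift map Z_{ℱΛ}(λ) → Z_{ℱΛ}(s(λ)), x ↦ λ⁻¹·x, is a continuous bijection whose inverse is the right-shift map y ↦ λ·y, and the image of Z_{ℱΛ}(λλ') under the left-shift map is exactly Z_{ℱΛ}(λ'). -/

import Mathlib

set_option autoImplicit false

/-- The topology on the power set `Set α` obtained by identifying it with the
product `∏ _ : α, Prop` where each (two-point) factor `Prop` carries the
discrete topology. -/
instance powersetTopology (α : Type) : TopologicalSpace (Set α) :=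
  @Pi.topologicalSpace α (fun _ => Prop) (fun _ => ⊥)

/-- The cylinder `Z(K₁;K₂) = {x : K₁ ⊆ x ⊆ K₂ᶜ}`. -/
def cylinder {α : Type} (K₁ K₂ : Set α) : Set (Set α) :=
  {x | K₁ ⊆ x ∧ x ⊆ K₂ᶜ}

/-- The relation `p ≤ r` iff `p * q = r` for some `q ∈ P`. -/
def Submonoid.leftLE {Q : Type} [Group Q] (P : Submonoid Q) (p r : Q) : Prop :=
  ∃ q ∈ P, p * q = r

/-- A weakly quasi-lattice ordered group `(Q,P)`: a group `Q` together with a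
subsemigroup `P` containing the unit with `P ∩ P⁻¹ = {e}`, such that any two
elements of `P` with a common upper bound (for `leftLE`) have a least common
upper bound. -/
structure WQLO (Q : Type) [Group Q] where
  P : Submonoid Q
  inter_inv : ∀ p ∈ P, p⁻¹ ∈ P → p = 1
  lub : ∀ a ∈ P, ∀ b ∈ P, (∃ c ∈ P, P.leftLE a c ∧ P.leftLE b c) →
    ∃ l ∈ P, P.leftLE a l ∧ P.leftLE b l ∧
      ∀ c ∈ P, P.leftLE a c → P.leftLE b c → P.leftLE l c

/-- A (discrete) `P`-graph: a countable small category, presented by its set of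
morphisms `Λ` with range map `r`, source map `s` and a composition `mul`
(constrained by the axioms only on composable pairs, i.e. when `s μ = r ν`),
together with a degree functor `d : Λ → P` satisfying the unique factorisation
property. The units of `Λ` are exactly the elements of the form `r lam`. -/
structure PGraph (Q : Type) [Group Q] (W : WQLO Q) where
  Λ : Type
  countable : Countable Λ
  r : Λ → Λ
  s : Λ → Λ
  mul : Λ → Λ → Λ
  d : Λ → Q
  d_mem : ∀ lam, d lam ∈ W.P
  s_r : ∀ lam, s (r lam) = r lam
  r_r : ∀ lam, r (r lam) = r lam
  s_s : ∀ lam, s (s lam) = s lam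
  r_s : ∀ lam, r (s lam) = s lam
  id_mul : ∀ lam, mul (r lam) lam = lam
  mul_id : ∀ lam, mul lam (s lam) = lam
  r_mul : ∀ mu nu, s mu = r nu → r (mul mu nu) = r mu
  s_mul : ∀ mu nu, s mu = r nu → s (mul mu nu) = s nu
  mul_assoc : ∀ mu nu k, s mu = r nu → s nu = r k →
    mul (mul mu nu) k = mul mu (mul nu k)
  d_unit : ∀ lam, d (r lam) = 1
  d_mul : ∀ mu nu, s mu = r nu → d (mul mu nu) = d mu * d nu
  factor : ∀ lam, ∀ p ∈ W.P, ∀ q ∈ W.P, d lam = p * q →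
    ∃! mn : Λ × Λ, s mn.1 = r mn.2 ∧ mul mn.1 mn.2 = lam ∧ d mn.1 = p ∧ d mn.2 = q

namespace PGraph

variable {Q : Type} [Group Q] {W : WQLO Q} (G : PGraph Q W)

/-- `λΛ = {λμ : μ ∈ Λ, s λ = r μ}`. -/
def cone (lam : G.Λ) : Set G.Λ :=
  {x | ∃ mu, G.s lam = G.r mu ∧ x = G.mul lam mu}

/-- `λE = {λμ : μ ∈ E, s λ = r μ}`. -/
def coneSet (lam : G.Λ) (E : Set G.Λ) : Set G.Λ :=
  {x | ∃ mu ∈ E, G.s lam = G.r mu ∧ x = G.mul lam mu}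

/-- `Λ` is finitely aligned at the pair `(μ,ν)`. -/
def FinAlignedAtPair (mu nu : G.Λ) : Prop :=
  ∃ J : Finset G.Λ, G.cone mu ∩ G.cone nu = ⋃ lam ∈ (J : Set G.Λ), G.cone lam

/-- `Λ` is finitely aligned at `λ`. -/
def FinAlignedAt (lam : G.Λ) : Prop :=
  ∀ mu ∈ G.cone lam, ∀ nu : G.Λ, G.FinAlignedAtPair mu nu

/-- The finitely aligned part `FA(Λ)`. -/
def FA : Set G.Λ := {lam | G.FinAlignedAt lam}

/-- `FAr(Λ) = FA(Λ) ∪ r(FA(Λ))`. -/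
def FAr : Set G.Λ := G.FA ∪ G.r '' G.FA

/-- `μ ≼ λ` iff `μν = λ` for some `ν`. -/
def pre (mu lam : G.Λ) : Prop :=
  ∃ nu, G.s mu = G.r nu ∧ G.mul mu nu = lam

/-- A filter: a nonempty, hereditary and directed subset of `Λ`. -/
def IsFilter (x : Set G.Λ) : Prop :=
  x.Nonempty ∧ (∀ lam mu, G.pre lam mu → mu ∈ x → lam ∈ x) ∧
    ∀ mu ∈ x, ∀ nu ∈ x, ∃ lam ∈ x, G.pre mu lam ∧ G.pre nu lam

/-- The space `ℱΛ` of filters, with the subspace topology from `𝒫(Λ)`. -/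
abbrev FilterSpace := {x : Set G.Λ // G.IsFilter x}

/-- `Z_{ℱΛ}(μ;K) = {x ∈ ℱΛ : μ ∈ x ⊆ Λ∖K}`. -/
def Zf (mu : G.Λ) (K : Set G.Λ) : Set G.FilterSpace :=
  {x | mu ∈ x.1 ∧ x.1 ⊆ Kᶜ}

/-- An ultrafilter: a filter maximal with respect to inclusion. -/
def IsUltrafilter (x : Set G.Λ) : Prop :=
  G.IsFilter x ∧ ∀ y, G.IsFilter y → x ⊆ y → x = y

/-- The path space `PS(Λ)`: filters meeting `FA(Λ)` (as a set of subsets). -/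
def PS : Set (Set G.Λ) := {x | G.IsFilter x ∧ (x ∩ G.FA).Nonempty}

/-- The path space as a topological space (subspace of `𝒫(Λ)`). -/
abbrev PSpace := {x : Set G.Λ // x ∈ G.PS}

/-- The boundary-path space: the closure in `PS(Λ)` of the set of ultrafilters
lying in `PS(Λ)`. -/
def BPS : Set G.PSpace := closure {x : G.PSpace | G.IsUltrafilter x.1}

abbrev BPSpace := {x : G.PSpace // x ∈ G.BPS}

/-- The left shift `λ⁻¹·x = {μ : λμ ∈ x}`. -/
def lshift (lam : G.Λ) (x : Set G.Λ) : Set G.Λ :=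
  {mu | G.s lam = G.r mu ∧ G.mul lam mu ∈ x}

/-- The right shift `λ·x = {ζ : ζ ≼ λμ for some μ ∈ x}`. -/
def rshift (lam : G.Λ) (x : Set G.Λ) : Set G.Λ :=
  {z | ∃ mu ∈ x, G.s lam = G.r mu ∧ G.pre z (G.mul lam mu)}

/-- The action `x·m`: the left shift of `x` by the unique element of
`x ∩ Λ^m` (when it exists). -/
def act (x : Set G.Λ) (m : Q) : Set G.Λ :=
  ⋃ lam ∈ {l ∈ x | G.d l = m}, G.lshift lam x

/-- The domain `D_m = {x ∈ PS(Λ) : x ∩ Λ^m ≠ ∅}` of `T_m`. -/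
def Dom (m : Q) : Set (Set G.Λ) := {x ∈ G.PS | ∃ l ∈ x, G.d l = m}

/-- The range `R_m = {x·m : x ∈ D_m}` of `T_m`. -/
def Ran (m : Q) : Set (Set G.Λ) := {y | ∃ x ∈ G.Dom m, G.act x m = y}

end PGraph

namespace PGraph

variable {Q : Type} [Group Q] {W : WQLO Q} (G : PGraph Q W)

lemma mul_left_cancel {lam mu nu : G.Λ} (hmu : G.s lam = G.r mu) (hnu : G.s lam = G.r nu)
    (h : G.mul lam mu = G.mul lam nu) : mu = nu := by
  have hd : G.d mu = G.d nu := by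
    have := congrArg G.d h
    rw [G.d_mul _ _ hmu, G.d_mul _ _ hnu] at this
    exact _root_.mul_left_cancel this
  have h_eq := (G.factor (G.mul lam nu) (G.d lam) (G.d_mem lam) (G.d nu) (G.d_mem nu)
    (G.d_mul _ _ hnu)).unique (y₁ := (lam, mu)) (y₂ := (lam, nu))
    ⟨hmu, h, rfl, hd⟩ ⟨hnu, rfl, rfl, rfl⟩
  exact congrArg Prod.snd h_eq

variable {G}

lemma pre.r_eq {mu nu : G.Λ} (h : G.pre mu nu) : G.r mu = G.r nu := by
  obtain ⟨k, hk, rfl⟩ := h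
  exact (G.r_mul _ _ hk).symm

variable (G)

lemma pre_refl (mu : G.Λ) : G.pre mu mu :=
  ⟨G.s mu, (G.r_s mu).symm, G.mul_id mu⟩

variable {G}

lemma pre.trans {a b c : G.Λ} (hab : G.pre a b) (hbc : G.pre b c) : G.pre a c := by
  obtain ⟨k, hk, rfl⟩ := hab
  obtain ⟨l, hl, rfl⟩ := hbc
  rw [G.s_mul _ _ hk] at hl
  exact ⟨G.mul k l, by rw [G.r_mul _ _ hl, hk], (G.mul_assoc _ _ _ hk hl).symm⟩

lemma pre_mul {lam mu : G.Λ} (h : G.s lam = G.r mu) : G.pre lam (G.mul lam mu) :=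
  ⟨mu, h, rfl⟩

lemma pre.mul_left {lam mu nu : G.Λ} (h : G.s lam = G.r mu) (hp : G.pre mu nu) :
    G.pre (G.mul lam mu) (G.mul lam nu) := by
  obtain ⟨k, hk, rfl⟩ := hp
  exact ⟨k, by rw [G.s_mul _ _ h, hk], G.mul_assoc _ _ _ h hk⟩

lemma exists_eq_mul_of_mul_pre {lam mu z : G.Λ} (h : G.s lam = G.r mu)
    (hp : G.pre (G.mul lam mu) z) :
    ∃ nu, G.s lam = G.r nu ∧ G.pre mu nu ∧ G.mul lam nu = z := by
  obtain ⟨k, hk, rfl⟩ := hp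
  rw [G.s_mul _ _ h] at hk
  exact ⟨G.mul mu k, by rw [G.r_mul _ _ hk, h], pre_mul hk, (G.mul_assoc _ _ _ h hk).symm⟩

lemma pre_of_mul_pre_mul {lam mu nu : G.Λ} (hmu : G.s lam = G.r mu) (hnu : G.s lam = G.r nu)
    (hp : G.pre (G.mul lam mu) (G.mul lam nu)) : G.pre mu nu := by
  obtain ⟨k, hk, hmk, h_eq⟩ := exists_eq_mul_of_mul_pre hmu hp
  rwa [← G.mul_left_cancel hk hnu h_eq]

lemma IsFilter.r_eq {x : Set G.Λ} (hx : G.IsFilter x) {mu nu : G.Λ} (hmu : mu ∈ x)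
    (hnu : nu ∈ x) : G.r mu = G.r nu := by
  obtain ⟨k, -, h₁, h₂⟩ := hx.2.2 mu hmu nu hnu
  rw [h₁.r_eq, h₂.r_eq]

lemma s_mem_lshift {lam : G.Λ} {x : Set G.Λ} (hlam : lam ∈ x) : G.s lam ∈ G.lshift lam x :=
  ⟨(G.r_s lam).symm, by rwa [G.mul_id]⟩

lemma IsFilter.lshift {x : Set G.Λ} (hx : G.IsFilter x) {lam : G.Λ} (hlam : lam ∈ x) :
    G.IsFilter (G.lshift lam x) := by
  refine ⟨⟨_, s_mem_lshift hlam⟩, ?_, ?_⟩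
  · rintro mu nu hp ⟨hnu, hmem⟩
    have hmu : G.s lam = G.r mu := by rw [hnu, hp.r_eq]
    exact ⟨hmu, hx.2.1 _ _ (hp.mul_left hmu) hmem⟩
  · rintro mu ⟨hmu, hmu'⟩ nu ⟨hnu, hnu'⟩
    obtain ⟨z, hz, h₁, h₂⟩ := hx.2.2 _ hmu' _ hnu'
    obtain ⟨k, hk, hmk, rfl⟩ := exists_eq_mul_of_mul_pre hmu h₁
    exact ⟨k, ⟨hk, hz⟩, hmk, pre_of_mul_pre_mul hnu hk h₂⟩

lemma mem_rshift {lam : G.Λ} {y : Set G.Λ} (hy : G.s lam ∈ y) : lam ∈ G.rshift lam y :=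
  ⟨G.s lam, hy, (G.r_s lam).symm, pre_mul (G.r_s lam).symm⟩

lemma IsFilter.rshift {y : Set G.Λ} (hy : G.IsFilter y) {lam : G.Λ} (hlam : G.s lam ∈ y) :
    G.IsFilter (G.rshift lam y) := by
  refine ⟨⟨_, mem_rshift hlam⟩, ?_, ?_⟩
  · rintro z w hzw ⟨mu, hmu, hr, hw⟩
    exact ⟨mu, hmu, hr, hzw.trans hw⟩
  · rintro z ⟨mu, hmu, hr, hz⟩ w ⟨nu, hnu, hr', hw⟩
    obtain ⟨k, hk, h₁, h₂⟩ := hy.2.2 _ hmu _ hnu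
    exact ⟨G.mul lam k, ⟨k, hk, by rw [hr, h₁.r_eq], G.pre_refl _⟩,
      hz.trans (h₁.mul_left hr), hw.trans (h₂.mul_left hr')⟩

lemma IsFilter.rshift_lshift {x : Set G.Λ} (hx : G.IsFilter x) {lam : G.Λ} (hlam : lam ∈ x) :
    G.rshift lam (G.lshift lam x) = x := by
  ext z
  constructor
  · rintro ⟨mu, ⟨-, hmem⟩, -, hz⟩
    exact hx.2.1 _ _ hz hmem
  · intro hz
    obtain ⟨_, hw, ⟨mu, hmu, rfl⟩, hzw⟩ := hx.2.2 _ hlam _ hz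
    exact ⟨mu, ⟨hmu, hw⟩, hmu, hzw⟩

lemma IsFilter.lshift_rshift {y : Set G.Λ} (hy : G.IsFilter y) {lam : G.Λ}
    (hlam : G.s lam ∈ y) : G.lshift lam (G.rshift lam y) = y := by
  ext mu
  constructor
  · rintro ⟨hmu, nu, hnu, hr, hp⟩
    exact hy.2.1 _ _ (pre_of_mul_pre_mul hmu hr hp) hnu
  · intro hmu
    have hr : G.s lam = G.r mu := by rw [← G.r_s lam, hy.r_eq hlam hmu]
    exact ⟨hr, mu, hmu, hr, G.pre_refl _⟩

lemma continuous_lshift (lam : G.Λ) : Continuous (G.lshift lam) := by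
  refine @continuous_pi _ _ _ _ (fun _ => ⊥) _ fun mu => ?_
  by_cases h : G.s lam = G.r mu
  · have h_eq : (fun x : Set G.Λ => G.lshift lam x mu) = fun x => x (G.mul lam mu) :=
      funext fun x => propext ⟨And.right, fun hx => ⟨h, hx⟩⟩
    rw [h_eq]
    exact @continuous_apply _ _ (fun _ => ⊥) (G.mul lam mu)
  · have h_eq : (fun x : Set G.Λ => G.lshift lam x mu) = fun _ => False :=
      funext fun x => propext ⟨fun hx => h hx.1, False.elim⟩
    rw [h_eq]
    exact @continuous_const _ _ _ ⊥ _

end PGraph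

/-- The left-shift map `Z_{ℱΛ}(λ) → Z_{ℱΛ}(s λ)`, `x ↦ λ⁻¹·x`, is a continuous
bijection whose inverse is the right-shift map `y ↦ λ·y`, and the image of
`Z_{ℱΛ}(λλ')` under the left-shift map is exactly `Z_{ℱΛ}(λ')`. -/
theorem statement10 {Q : Type} [Group Q] {W : WQLO Q} (G : PGraph Q W)
    (lam lam' : G.Λ) (hc : G.s lam = G.r lam') :
    ∃ f : {x : G.FilterSpace // lam ∈ x.1} → {y : G.FilterSpace // G.s lam ∈ y.1},
    ∃ g : {y : G.FilterSpace // G.s lam ∈ y.1} → {x : G.FilterSpace // lam ∈ x.1},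
      (∀ x, (f x).1.1 = G.lshift lam x.1.1) ∧
      (∀ y, (g y).1.1 = G.rshift lam y.1.1) ∧
      Continuous f ∧ Function.Bijective f ∧
      (∀ x, g (f x) = x) ∧ (∀ y, f (g y) = y) ∧
      f '' {x | G.mul lam lam' ∈ x.1.1} = {y | lam' ∈ y.1.1} := by
  let f : {x : G.FilterSpace // lam ∈ x.1} → {y : G.FilterSpace // G.s lam ∈ y.1} :=
    fun x => ⟨⟨G.lshift lam x.1.1, x.1.2.lshift x.2⟩, PGraph.s_mem_lshift x.2⟩
  let g : {y : G.FilterSpace // G.s lam ∈ y.1} → {x : G.FilterSpace // lam ∈ x.1} :=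
    fun y => ⟨⟨G.rshift lam y.1.1, y.1.2.rshift y.2⟩, PGraph.mem_rshift y.2⟩
  have hgf : ∀ x, g (f x) = x := fun x =>
    Subtype.ext (Subtype.ext (x.1.2.rshift_lshift x.2))
  have hfg : ∀ y, f (g y) = y := fun y =>
    Subtype.ext (Subtype.ext (y.1.2.lshift_rshift y.2))
  refine ⟨f, g, fun _ => rfl, fun _ => rfl, ?_,
    Function.bijective_iff_has_inverse.2 ⟨g, hgf, hfg⟩, hgf, hfg, ?_⟩
  · exact (((PGraph.continuous_lshift lam).comp
      (continuous_subtype_val.comp continuous_subtype_val)).subtype_mk _).subtype_mk _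
  · ext y
    constructor
    · rintro ⟨x, hx, rfl⟩
      exact ⟨hc, hx⟩
    · intro hy
      have hmem : lam' ∈ (f (g y)).1.1 := by rw [hfg]; exact hy
      exact ⟨g y, hmem.2, hfg y⟩
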